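/- arXiv:1603.05111 — 2 statements merged into one kernel-verified Lean document; each statement's English description precedes it below -/
import Mathlib

section
/- Let n ≥ 5 and let A be an exceptional copositive n×n matrix possessing zeros u^1,…,u^n with Supp u^j = I_j for all j = 1,…,n. Then for every zero v of A there exists an index j ∈ {1,…,n} such that Supp v ⊆ I_j. -/
open Matrix

/-- A real symmetric matrix is copositive if its quadratic form is nonnegative on the
nonnegative orthant. -/
def Copositive {n : ℕ} (A : Matrix (Fin n) (Fin n) ℝ) : Prop :=
  ∀ x : Fin n → ℝ, (∀ i, 0 ≤ x i) → 0 ≤ x ⬝ᵥ A.mulVec x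

/-- A copositive matrix is exceptional if it is not the sum of a positive semidefinite matrix
and a symmetric entrywise nonnegative matrix. -/
def Exceptional {n : ℕ} (A : Matrix (Fin n) (Fin n) ℝ) : Prop :=
  ¬ ∃ P N : Matrix (Fin n) (Fin n) ℝ,
      P.PosSemidef ∧ N.IsSymm ∧ (∀ i j, 0 ≤ N i j) ∧ A = P + N

/-- A copositive matrix is extremal if in any decomposition into a sum of two copositive
matrices both summands are nonnegative multiples of it. -/
def ExtremalCopositive {n : ℕ} (A : Matrix (Fin n) (Fin n) ℝ) : Prop :=
  Copositive A ∧ ∀ A₁ A₂ : Matrix (Fin n) (Fin n) ℝ, Copositive A₁ → Copositive A₂ →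
    A = A₁ + A₂ → ∃ c₁ c₂ : ℝ, 0 ≤ c₁ ∧ 0 ≤ c₂ ∧ A₁ = c₁ • A ∧ A₂ = c₂ • A

/-- A zero of a copositive matrix: a nonzero nonnegative vector on which the quadratic
form vanishes. -/
def IsZeroOf {n : ℕ} (A : Matrix (Fin n) (Fin n) ℝ) (u : Fin n → ℝ) : Prop :=
  u ≠ 0 ∧ (∀ i, 0 ≤ u i) ∧ u ⬝ᵥ A.mulVec u = 0

/-- The support of a vector: the set of indices of its positive entries. -/
def supp {n : ℕ} (u : Fin n → ℝ) : Set (Fin n) := {i | 0 < u i}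

/-- The embedding of `Fin (n-2)` into `Fin n` enumerating the cyclic index set
`I_j = {j, j+1, ..., j+(n-3)}` (0-based). -/
def circEmb (n : ℕ) (j : Fin n) : Fin (n - 2) → Fin n :=
  fun s => j + Fin.castLE (Nat.sub_le n 2) s

/-- The cyclic index set `I_j` of cardinality `n-2`. -/
def circIdx (n : ℕ) (j : Fin n) : Set (Fin n) := Set.range (circEmb n j)

/-- The principal submatrix `A_{I_j}`. -/
def circSub {n : ℕ} (A : Matrix (Fin n) (Fin n) ℝ) (j : Fin n) :
    Matrix (Fin (n - 2)) (Fin (n - 2)) ℝ :=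
  A.submatrix (circEmb n j) (circEmb n j)

/-- A minimal zero of a copositive matrix: a zero whose support does not strictly
contain the support of another zero. -/
def MinimalZero {n : ℕ} (A : Matrix (Fin n) (Fin n) ℝ) (u : Fin n → ℝ) : Prop :=
  IsZeroOf A u ∧ ∀ v, IsZeroOf A v → ¬ (supp v ⊂ supp u)

section QuadraticForm

variable {ι : Type*} [Fintype ι]

theorem dotProduct_mulVec_add_smul_self {A : Matrix ι ι ℝ} (hA : A.IsSymm) (z h : ι → ℝ) (t : ℝ) :
    (z + t • h) ⬝ᵥ A *ᵥ (z + t • h) =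
      z ⬝ᵥ A *ᵥ z + 2 * t * (A *ᵥ z ⬝ᵥ h) + t ^ 2 * (h ⬝ᵥ A *ᵥ h) := by
  have hzh : z ⬝ᵥ A *ᵥ h = A *ᵥ z ⬝ᵥ h := by
    rw [dotProduct_mulVec, ← mulVec_transpose, hA.eq]
  rw [mulVec_add, mulVec_smul, add_dotProduct, dotProduct_add, dotProduct_add, smul_dotProduct,
    smul_dotProduct, dotProduct_smul, dotProduct_smul, hzh, dotProduct_comm h (A *ᵥ z)]
  simp only [smul_eq_mul]
  ring

/-- The quadratic form of a copositive matrix is nonnegative on vectors supported in the support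
of a zero. -/
theorem nonneg_of_support_subset_zero {A : Matrix ι ι ℝ} (hA : A.IsSymm)
    (hcop : ∀ x : ι → ℝ, (∀ i, 0 ≤ x i) → 0 ≤ x ⬝ᵥ A *ᵥ x) {w : ι → ℝ} (hw : ∀ i, 0 ≤ w i)
    (hw0 : w ⬝ᵥ A *ᵥ w = 0) {x : ι → ℝ} (hx : ∀ i, ¬ 0 < w i → x i = 0) :
    0 ≤ x ⬝ᵥ A *ᵥ x := by
  have hex : ∀ i, ∃ ε > 0, ∀ δ, 0 < δ → δ ≤ ε → δ * |x i| ≤ w i := by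
    intro i
    by_cases h : 0 < w i
    · refine ⟨w i / (|x i| + 1), by positivity, fun δ hδ hle => ?_⟩
      rw [le_div_iff₀ (by positivity)] at hle
      nlinarith
    · exact ⟨1, one_pos, fun δ _ _ => by simp [hx i h, hw i]⟩
  choose ε hε hle using hex
  obtain ⟨δ, hδ, hδle⟩ : ∃ δ > 0, ∀ i, δ ≤ ε i := by
    rcases isEmpty_or_nonempty ι with h | h
    · exact ⟨1, one_pos, fun i => h.elim i⟩
    · obtain ⟨i₀, hi₀⟩ := Finite.exists_min ε
      exact ⟨ε i₀, hε i₀, hi₀⟩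
  have hb : ∀ i, |δ * x i| ≤ w i := fun i => by
    rw [abs_mul, abs_of_pos hδ]; exact hle i δ hδ (hδle i)
  have h1 := hcop (w + δ • x) fun i => by
    have := (abs_le.1 (hb i)).1
    simp only [Pi.add_apply, Pi.smul_apply, smul_eq_mul]; linarith
  have h2 := hcop (w + (-δ) • x) fun i => by
    have := (abs_le.1 (hb i)).2
    simp only [Pi.add_apply, Pi.smul_apply, smul_eq_mul]; linarith
  rw [dotProduct_mulVec_add_smul_self hA, hw0] at h1 h2
  have : 0 ≤ δ ^ 2 * (x ⬝ᵥ A *ᵥ x) := by linarith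
  exact nonneg_of_mul_nonneg_right this (by positivity)

theorem nonneg_of_linear_add_quadratic {a b : ℝ}
    (h : ∀ t, 0 ≤ t → t ≤ 1 → 0 ≤ 2 * t * a + t ^ 2 * b) : 0 ≤ a := by
  by_contra! ha
  have hd : 0 < |b| - a := by linarith [abs_nonneg b]
  have ht1 : -a / (|b| - a) ≤ 1 := by
    rw [div_le_one hd]; linarith [abs_nonneg b]
  have ht0 : 0 < -a / (|b| - a) := div_pos (by linarith) hd
  have h1 := h _ ht0.le ht1
  set t := -a / (|b| - a) with ht
  have htd : t * (|b| - a) = -a := by rw [ht]; field_simp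
  have : 0 ≤ t * (2 * a + t * b) := by linarith
  have h2 := nonneg_of_mul_nonneg_right this ht0
  nlinarith [le_abs_self b]

theorem posSemidef_of_isSymm_of_nonneg {A : Matrix ι ι ℝ} (hA : A.IsSymm)
    (h : ∀ x : ι → ℝ, 0 ≤ x ⬝ᵥ A *ᵥ x) : A.PosSemidef := by
  refine PosSemidef.of_dotProduct_mulVec_nonneg ?_ fun x => by simpa using h x
  rw [IsHermitian, conjTranspose_eq_transpose_of_trivial, hA.eq]

theorem eq_zero_of_zero_of_pos {P N : Matrix ι ι ℝ} (hP : P.PosSemidef) (hN : ∀ i j, 0 ≤ N i j)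
    {w : ι → ℝ} (hw : ∀ i, 0 ≤ w i) (hw0 : w ⬝ᵥ (P + N) *ᵥ w = 0) {i j : ι}
    (hi : 0 < w i) (hj : 0 < w j) : N i j = 0 := by
  have h1 : 0 ≤ w ⬝ᵥ P *ᵥ w := by simpa using hP.dotProduct_mulVec_nonneg w
  rw [add_mulVec, dotProduct_add] at hw0
  have h2 : w i * (N i j * w j) ≤ w ⬝ᵥ N *ᵥ w :=
    calc w i * (N i j * w j) ≤ w i * (N *ᵥ w) i :=
          mul_le_mul_of_nonneg_left (Finset.single_le_sum (f := fun j => N i j * w j)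
            (fun j _ => mul_nonneg (hN i j) (hw j)) (Finset.mem_univ j)) hi.le
      _ ≤ _ := Finset.single_le_sum (f := fun i => w i * (N *ᵥ w) i)
            (fun i _ => mul_nonneg (hw i)
              (Finset.sum_nonneg fun j _ => mul_nonneg (hN i j) (hw j))) (Finset.mem_univ i)
  by_contra h
  have hpos : 0 < N i j := lt_of_le_of_ne (hN i j) (Ne.symm h)
  have : 0 < w i * (N i j * w j) := by positivity
  linarith

variable [DecidableEq ι]

/-- A quadratic form that is coercive on the hyperplane `x k = 0` attains its minimum on the slice
`x k = 1` of the nonnegative orthant. -/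
theorem exists_min_on_slice {A : Matrix ι ι ℝ} (hA : A.IsSymm) {k : ι} {ε : ℝ} (hε : 0 < ε)
    (hk : ∀ x : ι → ℝ, x k = 0 → ε * (x ⬝ᵥ x) ≤ x ⬝ᵥ A *ᵥ x) :
    ∃ y : ι → ℝ, (∀ i, 0 ≤ y i) ∧ y k = 0 ∧ ∀ x : ι → ℝ, (∀ i, 0 ≤ x i) → x k = 0 →
      (Pi.single k 1 + y) ⬝ᵥ A *ᵥ (Pi.single k 1 + y) ≤
        (Pi.single k 1 + x) ⬝ᵥ A *ᵥ (Pi.single k 1 + x) := by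
  set e : ι → ℝ := Pi.single k 1
  set b : ι → ℝ := A *ᵥ e
  set M : ℝ := ∑ i, b i ^ 2 / ε with hM
  have hM0 : 0 ≤ M := Finset.sum_nonneg fun i _ => by positivity
  have hexp (x : ι → ℝ) : (e + x) ⬝ᵥ A *ᵥ (e + x) =
      e ⬝ᵥ A *ᵥ e + 2 * (b ⬝ᵥ x) + x ⬝ᵥ A *ᵥ x := by
    simpa [b] using dotProduct_mulVec_add_smul_self hA e x 1
  set R : ι → ℝ := Function.update (fun _ => 4 * M / ε + 1) k 0 with hR
  have hR0 : 0 ≤ R := fun i => by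
    by_cases h : i = k
    · subst h; simp [hR]
    · simp only [hR, Function.update_of_ne h, Pi.zero_apply]; positivity
  have hcont : Continuous fun x : ι → ℝ => (e + x) ⬝ᵥ A *ᵥ (e + x) := by fun_prop
  obtain ⟨y, hy, hmin⟩ := (isCompact_Icc (a := (0 : ι → ℝ)) (b := R)).exists_isMinOn
    ⟨0, le_rfl, hR0⟩ hcont.continuousOn
  have hyk : y k = 0 := le_antisymm (by simpa [hR] using hy.2 k) (hy.1 k)
  refine ⟨y, hy.1, hyk, fun x hx hxk => ?_⟩
  by_cases hxR : x ≤ R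
  · exact hmin ⟨hx, hxR⟩
  have h0 : (e + y) ⬝ᵥ A *ᵥ (e + y) ≤ e ⬝ᵥ A *ᵥ e := by
    simpa using hmin (show (0 : ι → ℝ) ∈ Set.Icc 0 R from ⟨le_rfl, hR0⟩)
  refine h0.trans ?_
  rw [hexp]
  obtain ⟨i, hi⟩ : ∃ i, R i < x i := by simpa [Pi.le_def] using hxR
  have hik : i ≠ k := by
    rintro rfl
    simp [hR, hxk] at hi
  have hRi : 4 * M / ε + 1 < x i := by simpa [hR, Function.update_of_ne hik] using hi
  have hsum : ε / 2 * x i ^ 2 - 2 * M ≤ 2 * (b ⬝ᵥ x) + ε * (x ⬝ᵥ x) := by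
    have h1 : ∑ j, (ε / 2 * x j ^ 2 - 2 * (b j ^ 2 / ε)) ≤
        ∑ j, (2 * (b j * x j) + ε * (x j * x j)) := by
      refine Finset.sum_le_sum fun j _ => ?_
      have : 0 ≤ (ε * x j + 2 * b j) ^ 2 / (2 * ε) := by positivity
      have h2 : (ε * x j + 2 * b j) ^ 2 / (2 * ε) =
        2 * (b j * x j) + ε * (x j * x j) - (ε / 2 * x j ^ 2 - 2 * (b j ^ 2 / ε)) := by
        field_simp; ring
      linarith
    have h3 : ε / 2 * x i ^ 2 ≤ ∑ j, ε / 2 * x j ^ 2 :=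
      Finset.single_le_sum (f := fun j => ε / 2 * x j ^ 2) (fun j _ => by positivity)
        (Finset.mem_univ i)
    simp only [Finset.sum_sub_distrib, Finset.sum_add_distrib, ← Finset.mul_sum] at h1 h3
    simp only [dotProduct, hM]
    linarith
  have hx1 : 1 ≤ x i := by
    have : 0 ≤ 4 * M / ε := by positivity
    linarith
  have hx2 : 4 * M ≤ ε * x i := by
    have : 4 * M / ε ≤ x i := by linarith
    rw [div_le_iff₀ hε] at this
    linarith
  have hx3 : ε * x i ≤ ε * x i ^ 2 := by nlinarith
  linarith [hk x hxk]

/-- The vector `l` is the gradient of the quadratic form at its minimizer on the slice `x k = 1` of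
the nonnegative orthant. -/
theorem exists_nonneg_correction_of_coercive {A : Matrix ι ι ℝ} (hA : A.IsSymm)
    (hcop : ∀ x : ι → ℝ, (∀ i, 0 ≤ x i) → 0 ≤ x ⬝ᵥ A *ᵥ x) {k : ι} {ε : ℝ} (hε : 0 < ε)
    (hk : ∀ x : ι → ℝ, x k = 0 → ε * (x ⬝ᵥ x) ≤ x ⬝ᵥ A *ᵥ x) :
    ∃ l : ι → ℝ, (∀ i, 0 ≤ l i) ∧ l k = 0 ∧
      ∀ x : ι → ℝ, 2 * x k * (l ⬝ᵥ x) ≤ x ⬝ᵥ A *ᵥ x := by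
  obtain ⟨y, hy, hyk, hmin⟩ := exists_min_on_slice hA hε hk
  set e : ι → ℝ := Pi.single k 1 with he
  set z := e + y with hz
  have hzk : z k = 1 := by simp [hz, he, hyk]
  have hdir (h : ι → ℝ) (hh : ∀ i, 0 ≤ y i + h i) (hhk : h k = 0) : 0 ≤ A *ᵥ z ⬝ᵥ h := by
    refine nonneg_of_linear_add_quadratic (b := h ⬝ᵥ A *ᵥ h) fun t ht0 ht1 => ?_
    have := hmin (y + t • h) (fun i => ?_) (by simp [hyk, hhk])
    · rw [← add_assoc, ← hz, dotProduct_mulVec_add_smul_self hA] at this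
      linarith
    · simp only [Pi.add_apply, Pi.smul_apply, smul_eq_mul]
      nlinarith [hy i, hh i]
  set l : ι → ℝ := Function.update (A *ᵥ z) k 0 with hl
  have hlx (x : ι → ℝ) : A *ᵥ z ⬝ᵥ x = l ⬝ᵥ x + (A *ᵥ z) k * x k := by
    have : A *ᵥ z = l + (A *ᵥ z) k • e := by
      ext i
      by_cases h : i = k
      · subst h; simp [hl, he]
      · simp [hl, he, h]
    conv_lhs => rw [this]
    simp [add_dotProduct, he]
  have hl0 : ∀ i, 0 ≤ l i := by
    intro i
    by_cases h : i = k
    · subst h; simp [hl]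
    · have := hdir (Pi.single i 1) (fun j => ?_) (by simp [Ne.symm h])
      · simpa [hl, h] using this
      · have : (0 : ι → ℝ) ≤ Pi.single i 1 := by simp
        exact add_nonneg (hy j) (this j)
  have hlk : l k = 0 := by simp [hl]
  have hly : l ⬝ᵥ y = 0 := by
    have h1 := hdir (-y) (fun i => by simp) (by simp [hyk])
    rw [hlx] at h1
    simp only [dotProduct_neg, Pi.neg_apply, hyk] at h1
    have h2 : 0 ≤ l ⬝ᵥ y := Finset.sum_nonneg fun i _ => mul_nonneg (hl0 i) (hy i)
    linarith
  have hlz : l ⬝ᵥ z = 0 := by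
    rw [hz, dotProduct_add, hly]; simp [he, hlk]
  refine ⟨l, hl0, hlk, fun x => ?_⟩
  obtain ⟨h, hhk, hx⟩ : ∃ h : ι → ℝ, h k = 0 ∧ x = h + x k • z :=
    ⟨x - x k • z, by simp [hzk], by simp⟩
  set c := x k
  have hcopz : 0 ≤ z ⬝ᵥ A *ᵥ z := hcop z fun i => by
    have : (0 : ι → ℝ) ≤ e := by simp [he]
    exact add_nonneg (this i) (hy i)
  have hh : 0 ≤ h ⬝ᵥ A *ᵥ h := by
    have : 0 ≤ h ⬝ᵥ h := Finset.sum_nonneg fun i _ => mul_self_nonneg _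
    exact (by positivity : 0 ≤ ε * (h ⬝ᵥ h)).trans (hk h hhk)
  have hswap : A *ᵥ h ⬝ᵥ z = l ⬝ᵥ h := by
    rw [dotProduct_comm, dotProduct_mulVec, ← mulVec_transpose, hA.eq, hlx, hhk]; ring
  have hlin : l ⬝ᵥ x = l ⬝ᵥ h := by
    rw [hx, dotProduct_add, dotProduct_smul, hlz]; simp
  rw [hlin, hx, dotProduct_mulVec_add_smul_self hA, hswap]
  nlinarith [mul_nonneg (sq_nonneg c) hcopz]

/-- If the quadratic form of a copositive matrix is nonnegative on the hyperplane `x k = 0`, it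
dominates `2 * x k * (l ⬝ᵥ x)` for some nonnegative vector `l`. -/
theorem exists_nonneg_correction {A : Matrix ι ι ℝ} (hA : A.IsSymm)
    (hcop : ∀ x : ι → ℝ, (∀ i, 0 ≤ x i) → 0 ≤ x ⬝ᵥ A *ᵥ x) {k : ι}
    (hk : ∀ x : ι → ℝ, x k = 0 → 0 ≤ x ⬝ᵥ A *ᵥ x) :
    ∃ l : ι → ℝ, (∀ i, 0 ≤ l i) ∧ ∀ x : ι → ℝ, 2 * x k * (l ⬝ᵥ x) ≤ x ⬝ᵥ A *ᵥ x := by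
  have hform (ε : ℝ) (x : ι → ℝ) :
      x ⬝ᵥ (A + ε • (1 : Matrix ι ι ℝ)) *ᵥ x = x ⬝ᵥ A *ᵥ x + ε * (x ⬝ᵥ x) := by
    simp [add_mulVec, smul_mulVec, dotProduct_add]
  have hxx (x : ι → ℝ) : 0 ≤ x ⬝ᵥ x := Finset.sum_nonneg fun i _ => mul_self_nonneg _
  have hreg (m : ℕ) : ∃ l : ι → ℝ, (∀ i, 0 ≤ l i) ∧ l k = 0 ∧
      ∀ x : ι → ℝ, 2 * x k * (l ⬝ᵥ x) ≤ x ⬝ᵥ A *ᵥ x + 1 / ((m : ℝ) + 1) * (x ⬝ᵥ x) := by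
    have hε : 0 < 1 / ((m : ℝ) + 1) := by positivity
    simp only [← hform]
    refine exists_nonneg_correction_of_coercive ?_ ?_ hε ?_
    · exact hA.add (isSymm_one.smul _)
    · intro x hx
      rw [hform]
      exact add_nonneg (hcop x hx) (mul_nonneg hε.le (hxx x))
    · intro x hx
      rw [hform]
      linarith [hk x hx]
  choose l hl0 hlk hl using hreg
  set w : ι → ι → ℝ := fun i => Pi.single i 1 + Pi.single k 1 with hw
  set R : ι → ℝ := fun i => |w i ⬝ᵥ A *ᵥ w i + w i ⬝ᵥ w i| with hR
  have hlR (m : ℕ) : l m ∈ Set.Icc 0 R := by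
    refine ⟨hl0 m, fun i => ?_⟩
    by_cases h : i = k
    · rw [h, hlk]; exact abs_nonneg _
    · have h1 := hl m (w i)
      have h2 : w i k = 1 := by simp [hw, Ne.symm h]
      have h3 : l m ⬝ᵥ w i = l m i := by simp [hw, dotProduct_add, hlk]
      have h4 : 1 / ((m : ℝ) + 1) ≤ 1 := by
        rw [div_le_one (by positivity)]; linarith [(Nat.cast_nonneg m : (0 : ℝ) ≤ m)]
      rw [h2, h3] at h1
      have h5 := mul_le_mul_of_nonneg_right h4 (hxx (w i))
      refine le_trans ?_ (le_abs_self _)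
      linarith [hl0 m i]
  obtain ⟨L, hL, φ, hφ, hlim⟩ := isCompact_Icc.tendsto_subseq hlR
  refine ⟨L, hL.1, fun x => ?_⟩
  have hleft : Filter.Tendsto (fun m => 2 * x k * (l (φ m) ⬝ᵥ x)) Filter.atTop
      (nhds (2 * x k * (L ⬝ᵥ x))) :=
    ((by fun_prop : Continuous fun q : ι → ℝ => 2 * x k * (q ⬝ᵥ x)).tendsto L).comp hlim
  have hright : Filter.Tendsto
      (fun m => x ⬝ᵥ A *ᵥ x + 1 / ((φ m : ℝ) + 1) * (x ⬝ᵥ x)) Filter.atTop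
      (nhds (x ⬝ᵥ A *ᵥ x + 0 * (x ⬝ᵥ x))) :=
    (((tendsto_one_div_add_atTop_nhds_zero_nat (𝕜 := ℝ)).comp
      hφ.tendsto_atTop).mul_const _).const_add _
  have := le_of_tendsto_of_tendsto' hleft hright fun m => hl (φ m) x
  simpa using this

/-- A copositive matrix whose quadratic form is nonnegative on a coordinate hyperplane is the sum
of a positive semidefinite and a symmetric entrywise nonnegative matrix. -/
theorem exists_posSemidef_add_nonneg {A : Matrix ι ι ℝ} (hA : A.IsSymm)
    (hcop : ∀ x : ι → ℝ, (∀ i, 0 ≤ x i) → 0 ≤ x ⬝ᵥ A *ᵥ x) {k : ι}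
    (hk : ∀ x : ι → ℝ, x k = 0 → 0 ≤ x ⬝ᵥ A *ᵥ x) :
    ∃ P N : Matrix ι ι ℝ, P.PosSemidef ∧ N.IsSymm ∧ (∀ i j, 0 ≤ N i j) ∧ A = P + N := by
  obtain ⟨l, hl0, hl⟩ := exists_nonneg_correction hA hcop hk
  set e : ι → ℝ := Pi.single k 1 with he
  have he0 : (0 : ι → ℝ) ≤ e := by simp [he]
  set N : Matrix ι ι ℝ := vecMulVec l e + vecMulVec e l with hN
  have hNs : N.IsSymm := by
    rw [IsSymm, hN, transpose_add, transpose_vecMulVec, transpose_vecMulVec, add_comm]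
  refine ⟨A - N, N, posSemidef_of_isSymm_of_nonneg (hA.sub hNs) fun x => ?_, hNs, fun i j => ?_, by simp⟩
  · have h1 : x ⬝ᵥ N *ᵥ x = 2 * x k * (l ⬝ᵥ x) := by
      have hex : e ⬝ᵥ x = x k := by simp [he]
      rw [hN, add_mulVec, dotProduct_add, vecMulVec_mulVec, vecMulVec_mulVec, hex]
      simp only [op_smul_eq_smul, dotProduct_smul, smul_eq_mul, dotProduct_comm x l,
        dotProduct_comm x e, hex]
      ring
    rw [sub_mulVec, dotProduct_sub, h1]
    linarith [hl x]
  · simp only [hN, Matrix.add_apply, vecMulVec_apply]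
    exact add_nonneg (mul_nonneg (hl0 i) (he0 j)) (mul_nonneg (he0 i) (hl0 j))

/-- If a copositive matrix has zeros vanishing exactly at `{p, k}` and exactly at `{k, q}`, and a
zero vanishing at `k` but neither at `p` nor at `q`, then its quadratic form is nonnegative on the
hyperplane `x k = 0`. -/
theorem nonneg_on_hyperplane_of_zeros {A : Matrix ι ι ℝ} (hA : A.IsSymm)
    (hcop : ∀ x : ι → ℝ, (∀ i, 0 ≤ x i) → 0 ≤ x ⬝ᵥ A *ᵥ x) {p k q : ι} {a b v : ι → ℝ}
    (ha : ∀ i, 0 ≤ a i) (ha0 : a ⬝ᵥ A *ᵥ a = 0) (has : ∀ i, 0 < a i ↔ i ≠ k ∧ i ≠ p)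
    (hb : ∀ i, 0 ≤ b i) (hb0 : b ⬝ᵥ A *ᵥ b = 0) (hbs : ∀ i, 0 < b i ↔ i ≠ k ∧ i ≠ q)
    (hv : ∀ i, 0 ≤ v i) (hv0 : v ⬝ᵥ A *ᵥ v = 0) (hvk : v k = 0)
    (hpq : p ≠ q) (hvp : 0 < v p) (hvq : 0 < v q)
    {x : ι → ℝ} (hxk : x k = 0) : 0 ≤ x ⬝ᵥ A *ᵥ x := by
  set D : Matrix ι ι ℝ := diagonal (Function.update 1 k 0) with hD
  have hDx (x : ι → ℝ) : D *ᵥ x = Function.update x k 0 := by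
    ext i
    by_cases h : i = k
    · subst h; simp [hD, mulVec_diagonal]
    · simp [hD, mulVec_diagonal, h]
  have hform (x : ι → ℝ) : x ⬝ᵥ (D * A * D) *ᵥ x =
      Function.update x k 0 ⬝ᵥ A *ᵥ Function.update x k 0 := by
    rw [← mulVec_mulVec, ← mulVec_mulVec, dotProduct_mulVec, ← mulVec_transpose, hDx,
      show Dᵀ = D from diagonal_transpose _, hDx]
  have hform0 {x : ι → ℝ} (hx : x k = 0) : x ⬝ᵥ (D * A * D) *ᵥ x = x ⬝ᵥ A *ᵥ x := by
    rw [hform, ← hx, Function.update_eq_self]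
  have hB : (D * A * D).IsSymm := by
    rw [IsSymm, transpose_mul, transpose_mul, hA.eq, show Dᵀ = D from diagonal_transpose _,
      Matrix.mul_assoc]
  obtain ⟨P, N, hP, -, hN, hPN⟩ := exists_posSemidef_add_nonneg (k := p) hB
    (fun x hx => by
      rw [hform]
      refine hcop _ fun i => ?_
      by_cases h : i = k
      · subst h; simp
      · simpa [h] using hx i)
    (fun x hxp => by
      rw [hform]
      refine nonneg_of_support_subset_zero hA hcop ha ha0 fun i hi => ?_
      rw [has] at hi
      by_cases h : i = k
      · subst h; simp
      · have hip : i = p := by tauto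
        rw [Function.update_of_ne h, hip, hxp])
  have hzero {w : ι → ℝ} (hw : ∀ i, 0 ≤ w i) (hw0 : w ⬝ᵥ A *ᵥ w = 0) (hwk : w k = 0) {i j : ι}
      (hi : 0 < w i) (hj : 0 < w j) : N i j = 0 :=
    eq_zero_of_zero_of_pos hP hN hw (by rw [← hPN, hform0 hwk, hw0]) hi hj
  have hak : a k = 0 := le_antisymm (not_lt.1 fun h => ((has k).1 h).1 rfl) (ha k)
  have hbk : b k = 0 := le_antisymm (not_lt.1 fun h => ((hbs k).1 h).1 rfl) (hb k)
  have hNz (i j : ι) (hi : i ≠ k) (hj : j ≠ k) : N i j = 0 := by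
    by_cases h1 : i ≠ p ∧ j ≠ p
    · exact hzero ha ha0 hak ((has i).2 ⟨hi, h1.1⟩) ((has j).2 ⟨hj, h1.2⟩)
    by_cases h2 : i ≠ q ∧ j ≠ q
    · exact hzero hb hb0 hbk ((hbs i).2 ⟨hi, h2.1⟩) ((hbs j).2 ⟨hj, h2.2⟩)
    have hi' : 0 < v i ∧ 0 < v j := by
      by_cases hip : i = p <;> by_cases hjp : j = p <;> by_cases hiq : i = q <;>
        by_cases hjq : j = q <;> simp_all
    exact hzero hv hv0 hvk hi'.1 hi'.2
  have hNx : x ⬝ᵥ N *ᵥ x = 0 := by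
    refine Finset.sum_eq_zero fun i _ => ?_
    by_cases hi : i = k
    · rw [hi, hxk, zero_mul]
    refine mul_eq_zero_of_right _ (Finset.sum_eq_zero fun j _ => ?_)
    by_cases hj : j = k
    · rw [hj, hxk, mul_zero]
    · exact mul_eq_zero_of_left (hNz i j hi hj) _
  rw [← hform0 hxk, hPN, add_mulVec, dotProduct_add, hNx, add_zero]
  simpa using hP.dotProduct_mulVec_nonneg x

end QuadraticForm

theorem mem_circIdx_iff {n : ℕ} [NeZero n] (hn : 2 ≤ n) (i j : Fin n) :
    i ∈ circIdx n j ↔ i ≠ j - 1 ∧ i ≠ j - 2 := by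
  obtain ⟨d, rfl⟩ : ∃ d, i = j + d := ⟨i - j, by abel⟩
  have h1 : (j + d = j - 1) ↔ d + 1 = 0 := by
    rw [sub_eq_add_neg, add_right_inj, eq_neg_iff_add_eq_zero]
  have h2 : (j + d = j - 2) ↔ d + 2 = 0 := by
    rw [sub_eq_add_neg, add_right_inj, eq_neg_iff_add_eq_zero]
  have hmem : j + d ∈ circIdx n j ↔ d.val < n - 2 := by
    constructor
    · rintro ⟨s, hs⟩
      have : Fin.castLE (Nat.sub_le n 2) s = d := add_left_cancel hs
      rw [← this]
      exact s.2
    · intro h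
      exact ⟨⟨d.val, h⟩, rfl⟩
  rw [hmem, Ne, Ne, h1, h2, Fin.ext_iff, Fin.ext_iff, Fin.val_add, Fin.val_add]
  obtain ⟨m, rfl⟩ : ∃ m, n = m + 2 := ⟨n - 2, by omega⟩
  have hd := d.2
  have h1 : (d.val + (1 : Fin (m + 2)).val) % (m + 2) = (d.val + 1) % (m + 2) := by simp
  have h2 : (d.val + (2 : Fin (m + 2)).val) % (m + 2) = (d.val + 2) % (m + 2) := by simp
  rw [h1, h2, Fin.val_zero, Nat.add_sub_cancel]
  rcases Nat.lt_trichotomy d.val m with h | h | h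
  · rw [Nat.mod_eq_of_lt (by omega), Nat.mod_eq_of_lt (by omega)]
    omega
  · simp [h]
  · have : d.val + 1 = m + 2 := by omega
    simp [this, h.not_gt]

theorem statement3 (n : ℕ) (hn : 5 ≤ n) (A : Matrix (Fin n) (Fin n) ℝ)
    (hA : A.IsSymm) (hcop : Copositive A) (hexc : Exceptional A)
    (u : Fin n → Fin n → ℝ)
    (hu : ∀ j, IsZeroOf A (u j) ∧ supp (u j) = circIdx n j)
    (v : Fin n → ℝ) (hv : IsZeroOf A v) :
    ∃ j : Fin n, supp v ⊆ circIdx n j := by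
  have : NeZero n := ⟨by omega⟩
  by_contra! hcon
  obtain ⟨-, hv0, hvA⟩ := hv
  have hpos (j i : Fin n) : 0 < u j i ↔ i ≠ j - 1 ∧ i ≠ j - 2 := by
    rw [← mem_circIdx_iff (by omega), ← (hu j).2]; rfl
  have hhit (j : Fin n) : 0 < v (j - 1) ∨ 0 < v (j - 2) := by
    obtain ⟨i, hi, hij⟩ := Set.not_subset.1 (hcon j)
    rw [mem_circIdx_iff (by omega)] at hij
    by_cases h : i = j - 1
    · exact Or.inl (h ▸ hi)
    · have : i = j - 2 := by tauto
      exact Or.inr (this ▸ hi)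
  by_cases hfull : ∀ i, 0 < v i
  · exact hexc ⟨A, 0, posSemidef_of_isSymm_of_nonneg hA fun x =>
      nonneg_of_support_subset_zero hA hcop hv0 hvA fun i hi => absurd (hfull i) hi,
      isSymm_zero, fun _ _ => le_rfl, (add_zero A).symm⟩
  push Not at hfull
  obtain ⟨k, hk⟩ := hfull
  have two : (2 : Fin n) = 1 + 1 := by
    ext; simp [Fin.val_add]
  have e1 : k + 1 - 1 = k := by abel
  have e2 : k + 1 - 2 = k - 1 := by rw [two]; abel
  have e3 : k + 2 - 1 = k + 1 := by rw [two]; abel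
  have e4 : k + 2 - 2 = k := by abel
  have hne : k - 1 ≠ k + 1 := by
    intro h
    have h0 : (2 : Fin n) = 0 := by
      rw [two, ← sub_eq_zero_of_eq h.symm]; abel
    have := congrArg Fin.val h0
    have h2 : ((2 : Fin n) : ℕ) = 2 % n := rfl
    rw [h2, Nat.mod_eq_of_lt (by omega)] at this
    simp at this
  have hp := hhit (k + 1)
  have hq := hhit (k + 2)
  rw [e1, e2] at hp
  rw [e3, e4] at hq
  have ha := hpos (k + 1)
  have hb := hpos (k + 2)
  rw [e1, e2] at ha
  rw [e3, e4] at hb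
  exact hexc (exists_posSemidef_add_nonneg hA hcop (k := k) fun x hx =>
    nonneg_on_hyperplane_of_zeros hA hcop (hu (k + 1)).1.2.1 (hu (k + 1)).1.2.2 ha
      (hu (k + 2)).1.2.1 (hu (k + 2)).1.2.2 (fun i => (hb i).trans and_comm) hv0 hvA
      (le_antisymm hk (hv0 k)) hne (hp.resolve_left hk.not_gt) (hq.resolve_right hk.not_gt) hx)
end

section
/- Let n ≥ 5 and let A be an exceptional copositive n×n matrix possessing zeros u^1,…,u^n with Supp u^j = I_j for all j = 1,…,n. Then exactly one of the following two cases holds: either (i) the principal submatrix A_{I_j} has rank n−3 (corank 1) for every j = 1,…,n, every zero of A is proportional to one of u^1,…,u^n, and each u^j is a minimal zero of A; or (ii) the principal submatrix A_{I_j} has rank n−4 (corank 2) for every j = 1,…,n. -/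
open Matrix

section QuadraticForm

variable {n : ℕ} {A : Matrix (Fin n) (Fin n) ℝ}

lemma Matrix.IsSymm.dotProduct_mulVec_comm (hA : A.IsSymm) (x y : Fin n → ℝ) :
    x ⬝ᵥ A.mulVec y = y ⬝ᵥ A.mulVec x := by
  rw [dotProduct_mulVec, ← mulVec_transpose, hA.eq, dotProduct_comm]

lemma quadForm_add_smul (hA : A.IsSymm) (x y : Fin n → ℝ) (t : ℝ) :
    (x + t • y) ⬝ᵥ A.mulVec (x + t • y) =
      x ⬝ᵥ A.mulVec x + 2 * t * (y ⬝ᵥ A.mulVec x) + t ^ 2 * (y ⬝ᵥ A.mulVec y) := by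
  simp only [mulVec_add, mulVec_smul, add_dotProduct, dotProduct_add, smul_dotProduct,
    dotProduct_smul, smul_eq_mul, hA.dotProduct_mulVec_comm x y]
  ring

lemma nonneg_of_forall_linear_add_quadratic_nonneg {a b : ℝ}
    (h : ∀ t : ℝ, 0 < t → t ≤ 1 → 0 ≤ 2 * t * a + t ^ 2 * b) : 0 ≤ a := by
  by_contra! ha
  have ha0 : 0 < |a| := abs_pos.2 ha.ne
  have hd : 0 < |b| + |a| := by positivity
  have ht : 0 < |a| / (|b| + |a|) := by positivity
  have ht1 : |a| / (|b| + |a|) ≤ 1 := by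
    rw [div_le_one hd]; linarith [abs_nonneg b]
  have key := h _ ht ht1
  set t := |a| / (|b| + |a|) with ht_def
  have h1 : t * (|b| + |a|) = |a| := by rw [ht_def]; field_simp
  have h2 : 0 ≤ 2 * a + t * b := by
    by_contra! h3
    nlinarith
  have h3 : t * b ≤ t * |b| := mul_le_mul_of_nonneg_left (le_abs_self b) ht.le
  have h4 : |a| = -a := abs_of_neg ha
  nlinarith [abs_nonneg a]

lemma IsZeroOf.mulVec_nonneg (hA : A.IsSymm) (hcop : Copositive A) {v : Fin n → ℝ}
    (hv : IsZeroOf A v) (i : Fin n) : 0 ≤ A.mulVec v i := by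
  refine nonneg_of_forall_linear_add_quadratic_nonneg (b := A i i) fun t ht _ => ?_
  have h := hcop (v + t • Pi.single i 1) fun k => by
    have h1 : (0 : ℝ) ≤ (Pi.single i 1 : Fin n → ℝ) k := by
      by_cases hk : k = i
      · subst hk; simp
      · simp [hk]
    have := hv.2.1 k
    simp only [Pi.add_apply, Pi.smul_apply, smul_eq_mul]
    positivity
  rw [quadForm_add_smul hA, hv.2.2] at h
  simpa using h

lemma IsZeroOf.mulVec_eq_zero (hA : A.IsSymm) (hcop : Copositive A) {v : Fin n → ℝ}
    (hv : IsZeroOf A v) {i : Fin n} (hi : 0 < v i) : A.mulVec v i = 0 := by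
  have h := (Finset.sum_eq_zero_iff_of_nonneg fun k _ =>
    mul_nonneg (hv.2.1 k) (hv.mulVec_nonneg hA hcop k)).1 hv.2.2 i (Finset.mem_univ i)
  exact (mul_eq_zero.1 h).resolve_left hi.ne'

lemma exists_pos_forall_add_smul_nonneg {v x : Fin n → ℝ} (hv : ∀ i, 0 ≤ v i)
    (hx : ∀ i, v i = 0 → 0 ≤ x i) : ∃ t : ℝ, 0 < t ∧ ∀ i, 0 ≤ v i + t * x i := by
  have h : ∀ i, ∀ᶠ t in nhdsWithin (0 : ℝ) (Set.Ioi 0), 0 ≤ v i + t * x i := fun i => by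
    rcases (hv i).eq_or_lt with h0 | h0
    · filter_upwards [self_mem_nhdsWithin] with t ht
      have := hx i h0.symm
      have ht' : 0 < t := ht
      rw [← h0]
      positivity
    · have hc : Filter.Tendsto (fun t : ℝ => v i + t * x i) (nhdsWithin 0 (Set.Ioi 0))
          (nhds (v i + 0 * x i)) :=
        (Continuous.tendsto (by fun_prop) 0).mono_left nhdsWithin_le_nhds
      rw [zero_mul, add_zero] at hc
      exact (hc.eventually (lt_mem_nhds h0)).mono fun _ h => h.le
  obtain ⟨t, h1, h2⟩ := ((Filter.eventually_all.2 h).and self_mem_nhdsWithin).exists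
  exact ⟨t, h2, h1⟩

lemma IsZeroOf.quadForm_nonneg (hA : A.IsSymm) (hcop : Copositive A) {v : Fin n → ℝ}
    (hv : IsZeroOf A v) {x : Fin n → ℝ} (hx : ∀ i, v i = 0 → x i = 0) :
    0 ≤ x ⬝ᵥ A.mulVec x := by
  obtain ⟨t, ht, h⟩ := exists_pos_forall_add_smul_nonneg hv.2.1 fun i hi => (hx i hi).ge
  have h1 := hcop (v + t • x) h
  have h2 : x ⬝ᵥ A.mulVec v = 0 := Finset.sum_eq_zero fun i _ => by
    rcases (hv.2.1 i).eq_or_lt with h0 | h0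
    · rw [hx i h0.symm, zero_mul]
    · rw [hv.mulVec_eq_zero hA hcop h0, mul_zero]
  rw [quadForm_add_smul hA, hv.2.2, h2] at h1
  have : 0 < t ^ 2 := by positivity
  nlinarith

/-- If a quadratic form is nonnegative on all vectors supported on a set, then it vanishes at
such a vector only if the gradient vanishes on that set. -/
lemma mulVec_eq_zero_of_quadForm_eq_zero (hA : A.IsSymm) {S : Set (Fin n)}
    (hS : ∀ x : Fin n → ℝ, (∀ i ∉ S, x i = 0) → 0 ≤ x ⬝ᵥ A.mulVec x) {x : Fin n → ℝ}
    (hx : ∀ i ∉ S, x i = 0) (h0 : x ⬝ᵥ A.mulVec x = 0) {i : Fin n} (hi : i ∈ S) :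
    A.mulVec x i = 0 := by
  have key : ∀ c : ℝ, 0 ≤ c * A.mulVec x i := fun c => by
    refine nonneg_of_forall_linear_add_quadratic_nonneg (b := c ^ 2 * A i i) fun t _ _ => ?_
    have h := hS (x + (t * c) • Pi.single i 1) fun k hk => by
      have : k ≠ i := fun h => hk (h ▸ hi)
      simp [hx k hk, this]
    rw [quadForm_add_smul hA, h0] at h
    simp only [single_one_dotProduct, mulVec_single_one, col_apply] at h
    linarith
  have h1 := key 1
  have h2 := key (-1)
  linarith

lemma Exceptional.exists_quadForm_neg (hA : A.IsSymm) (hexc : Exceptional A)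
    {N : Matrix (Fin n) (Fin n) ℝ} (hN : N.IsSymm) (hN0 : ∀ i j, 0 ≤ N i j) :
    ∃ x : Fin n → ℝ, x ⬝ᵥ (A - N).mulVec x < 0 := by
  by_contra! h
  refine hexc ⟨A - N, N, .of_dotProduct_mulVec_nonneg ?_ ?_, hN, hN0, by simp⟩
  · rw [IsHermitian, conjTranspose_eq_transpose_of_trivial]
    exact (hA.sub hN).eq
  · simpa using h

end QuadraticForm

section BorderedPosSemidef

variable {n : ℕ} {A : Matrix (Fin n) (Fin n) ℝ}

lemma quadForm_add_smul_one (A : Matrix (Fin n) (Fin n) ℝ) (ε : ℝ) (x : Fin n → ℝ) :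
    x ⬝ᵥ (A + ε • (1 : Matrix (Fin n) (Fin n) ℝ)).mulVec x =
      x ⬝ᵥ A.mulVec x + ε * (x ⬝ᵥ x) := by
  simp [add_mulVec, smul_mulVec, dotProduct_add]

/-- A strictly copositive quadratic form attains its minimum on the nonnegative vectors with a
given coordinate equal to `1`. -/
lemma Copositive.exists_isMinOn (hcop : Copositive A) {ε : ℝ} (hε : 0 < ε) (i₀ : Fin n) :
    ∃ x : Fin n → ℝ, ((∀ i, 0 ≤ x i) ∧ x i₀ = 1) ∧ ∀ y : Fin n → ℝ, (∀ i, 0 ≤ y i) → y i₀ = 1 →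
      x ⬝ᵥ (A + ε • (1 : Matrix (Fin n) (Fin n) ℝ)).mulVec x ≤
        y ⬝ᵥ (A + ε • (1 : Matrix (Fin n) (Fin n) ℝ)).mulVec y := by
  set Q := A + ε • (1 : Matrix (Fin n) (Fin n) ℝ) with hQ
  set e : Fin n → ℝ := Pi.single i₀ 1 with he
  have he0 : ∀ i, 0 ≤ e i := fun i => by
    by_cases h : i = i₀
    · subst h; simp [he]
    · simp [he, h]
  have he1 : e i₀ = 1 := by simp [he]
  set c := e ⬝ᵥ Q.mulVec e with hc
  have hcont : Continuous fun x : Fin n → ℝ => x ⬝ᵥ Q.mulVec x :=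
    continuous_id.dotProduct (continuous_const.matrix_mulVec continuous_id)
  set K : Set (Fin n → ℝ) :=
    {x | ((∀ i, 0 ≤ x i) ∧ x i₀ = 1) ∧ x ⬝ᵥ Q.mulVec x ≤ c} with hK
  have hclosed : IsClosed K := by
    refine IsClosed.inter (IsClosed.inter ?_ ?_) (isClosed_le hcont continuous_const)
    · exact isClosed_Ici (a := (0 : Fin n → ℝ))
    · exact isClosed_eq (continuous_apply i₀) continuous_const
  have hsub : K ⊆ Set.Icc 0 (fun _ => c / ε + 1) := by
    rintro x ⟨⟨hx0, -⟩, hx⟩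
    refine ⟨hx0, fun i => ?_⟩
    have h1 := hcop x hx0
    rw [hQ, quadForm_add_smul_one] at hx
    have h2 : x i * x i ≤ x ⬝ᵥ x :=
      Finset.single_le_sum (f := fun i => x i * x i) (fun i _ => mul_self_nonneg _)
        (Finset.mem_univ i)
    have h3 : x i * x i ≤ c / ε := by
      rw [le_div_iff₀ hε]; nlinarith
    show x i ≤ c / ε + 1
    nlinarith [sq_nonneg (x i - 1)]
  have hcomp : IsCompact K := isCompact_Icc.of_isClosed_subset hclosed hsub
  have heK : e ∈ K := ⟨⟨he0, he1⟩, le_rfl⟩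
  obtain ⟨x, hx, hmin⟩ := hcomp.exists_isMinOn ⟨_, heK⟩ hcont.continuousOn
  refine ⟨x, hx.1, fun y hy0 hy1 => ?_⟩
  by_cases h : y ⬝ᵥ Q.mulVec y ≤ c
  · exact hmin (show y ∈ K from ⟨⟨hy0, hy1⟩, h⟩)
  · exact (hmin heK).trans (not_le.1 h).le

/-- A copositive form that is nonnegative on a coordinate hyperplane becomes, after an arbitrarily
small positive definite perturbation, the sum of a positive semidefinite and a nonnegative form. -/
lemma Copositive.exists_nonneg_sub_quadForm_nonneg (hA : A.IsSymm) (hcop : Copositive A)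
    {i₀ : Fin n} (hpsd : ∀ x : Fin n → ℝ, x i₀ = 0 → 0 ≤ x ⬝ᵥ A.mulVec x)
    {ε : ℝ} (hε : 0 < ε) :
    ∃ N : Matrix (Fin n) (Fin n) ℝ, N.IsSymm ∧ (∀ i j, 0 ≤ N i j) ∧
      ∀ x : Fin n → ℝ, 0 ≤ x ⬝ᵥ A.mulVec x + ε * (x ⬝ᵥ x) - x ⬝ᵥ N.mulVec x := by
  obtain ⟨x, ⟨hx0, hx1⟩, hmin⟩ := hcop.exists_isMinOn hε i₀
  set Q := A + ε • (1 : Matrix (Fin n) (Fin n) ℝ) with hQdef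
  have hQ : Q.IsSymm := hA.add (isSymm_one.smul ε)
  set g := Q.mulVec x with hg
  have hgrad : ∀ d : Fin n → ℝ, d i₀ = 0 → (∀ i, 0 ≤ x i + d i) → 0 ≤ d ⬝ᵥ g := fun d hd hxd => by
    refine nonneg_of_forall_linear_add_quadratic_nonneg (b := d ⬝ᵥ Q.mulVec d) fun t ht ht1 => ?_
    have h := hmin (x + t • d) (fun i => ?_) (by simp [hx1, hd])
    · rw [quadForm_add_smul hQ] at h
      linarith
    · have h1 := hx0 i
      have h2 := hxd i
      simp only [Pi.add_apply, Pi.smul_apply, smul_eq_mul]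
      nlinarith
  have hg0 : ∀ k, k ≠ i₀ → 0 ≤ g k := fun k hk => by
    have h := hgrad (Pi.single k 1) (by simp [hk.symm]) fun i => by
      have h1 := hx0 i
      by_cases hi : i = k
      · subst hi; simp only [Pi.single_eq_same]; linarith
      · simpa [hi] using h1
    simpa using h
  have hgx : ∀ k, k ≠ i₀ → g k * x k = 0 := fun k hk => by
    have h := hgrad (Pi.single k (-x k)) (by simp [hk.symm]) fun i => by
      have h1 := hx0 i
      by_cases hi : i = k
      · subst hi; simp
      · simpa [hi] using h1
    rw [single_dotProduct] at h
    nlinarith [mul_nonneg (hg0 k hk) (hx0 k)]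
  set w : Fin n → ℝ := fun k => if k = i₀ then 0 else g k with hw
  set e : Fin n → ℝ := Pi.single i₀ 1 with he
  have hw0 : ∀ k, 0 ≤ w k := fun k => by
    by_cases hk : k = i₀
    · simp [hw, hk]
    · simpa [hw, hk] using hg0 k hk
  have he0 : ∀ i, 0 ≤ e i := fun i => by
    by_cases h : i = i₀
    · subst h; simp [he]
    · simp [he, h]
  refine ⟨vecMulVec e w + vecMulVec w e, ?_, fun i j => ?_, fun z => ?_⟩
  · rw [IsSymm, transpose_add, transpose_vecMulVec, transpose_vecMulVec, add_comm]
  · exact add_nonneg (mul_nonneg (he0 i) (hw0 j)) (mul_nonneg (hw0 i) (he0 j))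
  have hxg : x ⬝ᵥ g = g i₀ := by
    rw [dotProduct, Finset.sum_eq_single i₀ (fun k _ hk => by rw [mul_comm, hgx k hk]) (by simp),
      hx1, one_mul]
  have hgi : 0 ≤ g i₀ := by
    rw [← hxg, hg, hQdef, quadForm_add_smul_one]
    have h1 := hcop x hx0
    have h2 : 0 ≤ x ⬝ᵥ x := Finset.sum_nonneg fun i _ => mul_self_nonneg _
    positivity
  set y := z - z i₀ • x with hy
  have hz : z = y + z i₀ • x := by simp [hy]
  have hyi : y i₀ = 0 := by simp [hy, hx1]
  have hyQ : 0 ≤ y ⬝ᵥ Q.mulVec y := by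
    rw [hQdef, quadForm_add_smul_one]
    have h1 := hpsd y hyi
    have h2 : 0 ≤ y ⬝ᵥ y := Finset.sum_nonneg fun i _ => mul_self_nonneg _
    positivity
  have hgw : g = w + g i₀ • e := by
    ext k
    by_cases hk : k = i₀
    · subst hk; simp [hw, he]
    · simp [hw, he, hk]
  have hxw : x ⬝ᵥ w = 0 := Finset.sum_eq_zero fun k _ => by
    by_cases hk : k = i₀
    · simp [hw, hk]
    · simpa [hw, hk, mul_comm] using hgx k hk
  have hzw : z ⬝ᵥ w = y ⬝ᵥ g := by
    conv_lhs => rw [hz]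
    rw [hgw, add_dotProduct, smul_dotProduct, hxw, dotProduct_add, dotProduct_smul]
    simp [he, hyi]
  have hN : z ⬝ᵥ (vecMulVec e w + vecMulVec w e).mulVec z = 2 * z i₀ * (y ⬝ᵥ g) := by
    rw [add_mulVec, vecMulVec_mulVec, vecMulVec_mulVec, dotProduct_add, ← hzw, dotProduct_comm w z]
    simp [he]
    ring
  rw [hN, ← quadForm_add_smul_one, ← hQdef]
  have hzQ : z ⬝ᵥ Q.mulVec z = y ⬝ᵥ Q.mulVec y + 2 * z i₀ * (y ⬝ᵥ g) + z i₀ ^ 2 * g i₀ := by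
    conv_lhs => rw [hz]
    rw [quadForm_add_smul hQ, ← hg, hxg, hQ.dotProduct_mulVec_comm x y]
  rw [hzQ]
  have : 0 ≤ z i₀ ^ 2 * g i₀ := by positivity
  linarith

/-- An exceptional copositive form takes a negative value on every coordinate hyperplane. -/
lemma Exceptional.exists_quadForm_neg_of_coord_eq_zero (hA : A.IsSymm) (hcop : Copositive A)
    (hexc : Exceptional A) (i₀ : Fin n) :
    ∃ x : Fin n → ℝ, x i₀ = 0 ∧ x ⬝ᵥ A.mulVec x < 0 := by
  by_contra! hpsd
  choose N hNs hN0 hN using fun m : ℕ => hcop.exists_nonneg_sub_quadForm_nonneg hA hpsd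
    (Nat.one_div_pos_of_nat (n := m) (α := ℝ))
  set C : ℝ := ∑ i, ∑ j, (|A i i + 2 * A i j + A j j| + 4) with hC
  have hbound : ∀ m i j, N m i j ≤ C := fun m i j => by
    have h := hN m (Pi.single i 1 + (1 : ℝ) • Pi.single j 1)
    rw [quadForm_add_smul hA, quadForm_add_smul (hNs m)] at h
    have hε : 1 / ((m : ℝ) + 1) ≤ 1 := by
      rw [div_le_one (by positivity)]; linarith [Nat.cast_nonneg (α := ℝ) m]
    have hε0 : 0 ≤ 1 / ((m : ℝ) + 1) := by positivity
    have hd : (Pi.single i 1 + (1 : ℝ) • Pi.single j 1 : Fin n → ℝ) ⬝ᵥ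
        (Pi.single i 1 + (1 : ℝ) • Pi.single j 1) ≤ 4 := by
      by_cases hij : i = j
      · subst hij; simp; norm_num
      · simp [hij, Ne.symm hij]; norm_num
    have hij : |A i i + 2 * A i j + A j j| + 4 ≤ C :=
      (Finset.single_le_sum (f := fun j => |A i i + 2 * A i j + A j j| + 4)
        (fun _ _ => by positivity) (Finset.mem_univ j)).trans
        (Finset.single_le_sum (f := fun i => ∑ j, (|A i i + 2 * A i j + A j j| + 4))
        (fun _ _ => Finset.sum_nonneg fun _ _ => by positivity) (Finset.mem_univ i))
    simp only [single_one_dotProduct, mulVec_single_one, col_apply] at h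
    have h1 := hN0 m i i
    have h2 := hN0 m j j
    have h3 := hN0 m i j
    have h4 := hA.apply i j
    have h5 := (hNs m).apply i j
    have h6 := le_abs_self (A i i + 2 * A i j + A j j)
    nlinarith
  obtain ⟨L, -, φ, hφ, hL⟩ := (isCompact_univ_pi fun _ : Fin n => isCompact_univ_pi
      fun _ : Fin n => isCompact_Icc (a := (0 : ℝ)) (b := C)).tendsto_subseq
    (x := fun m i j => N m i j) fun m i _ j _ => ⟨hN0 m i j, hbound m i j⟩
  have hLij : ∀ i j, Filter.Tendsto (fun m => N (φ m) i j) Filter.atTop (nhds (L i j)) :=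
    fun i j => tendsto_pi_nhds.1 (tendsto_pi_nhds.1 hL i) j
  obtain ⟨x, hx⟩ := hexc.exists_quadForm_neg hA (N := of L)
    (IsSymm.ext fun i j => tendsto_nhds_unique (hLij j i)
      ((hLij i j).congr fun m => (hNs (φ m)).apply j i))
    fun i j => ge_of_tendsto' (hLij i j) fun m => hN0 (φ m) i j
  refine hx.not_ge (ge_of_tendsto' (f := fun m => x ⬝ᵥ A.mulVec x +
    1 / ((φ m : ℝ) + 1) * (x ⬝ᵥ x) - x ⬝ᵥ (N (φ m)).mulVec x) (x := Filter.atTop) ?_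
    fun m => hN (φ m) x)
  have h1 : Filter.Tendsto (fun m => 1 / ((φ m : ℝ) + 1)) Filter.atTop (nhds 0) :=
    tendsto_one_div_add_atTop_nhds_zero_nat.comp hφ.tendsto_atTop
  have h2 : Filter.Tendsto (fun m => x ⬝ᵥ (N (φ m)).mulVec x) Filter.atTop
      (nhds (x ⬝ᵥ (of L).mulVec x)) :=
    ((continuous_const.dotProduct (continuous_id.matrix_mulVec continuous_const)).tendsto
      (of L)).comp hL
  have h3 := (tendsto_const_nhds (x := x ⬝ᵥ A.mulVec x)).add (h1.mul_const (x ⬝ᵥ x)) |>.sub h2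
  rwa [zero_mul, add_zero, ← dotProduct_sub, ← sub_mulVec] at h3

end BorderedPosSemidef

section CyclicZeros

variable {n : ℕ} [NeZero n] {A : Matrix (Fin n) (Fin n) ℝ} {w : Fin n → Fin n → ℝ}

lemma Fin.add_one_ne_self (hn : 2 ≤ n) (k : Fin n) : k + 1 ≠ k := by
  rw [Ne, add_eq_left, Fin.ext_iff, Fin.val_one', Fin.val_zero, Nat.mod_eq_of_lt hn]
  simp

lemma Fin.add_one_add_one_ne_self (hn : 3 ≤ n) (k : Fin n) : k + 1 + 1 ≠ k := by
  rw [Ne, add_assoc, add_eq_left, Fin.ext_iff, Fin.val_add, Fin.val_one', Fin.val_zero,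
    Nat.mod_eq_of_lt (by omega : 1 < n), Nat.mod_eq_of_lt (by omega)]
  simp

lemma Fin.add_one_add_one_add_one_ne_self (hn : 4 ≤ n) (k : Fin n) : k + 1 + 1 + 1 ≠ k := by
  rw [Ne, add_assoc, add_assoc, add_eq_left, Fin.ext_iff, Fin.val_add, Fin.val_add, Fin.val_one',
    Fin.val_zero, Nat.mod_eq_of_lt (by omega : 1 < n), Nat.mod_eq_of_lt (by omega : 1 + 1 < n),
    Nat.mod_eq_of_lt (by omega)]
  simp

lemma Fin.forall_of_cyclic_succ {p : Fin n → Prop} (h : ∀ i, p i → p (i + 1)) {j : Fin n}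
    (hj : p j) (i : Fin n) : p i := by
  have key : ∀ m : ℕ, p (j + Fin.ofNat n m) := fun m => by
    induction m with
    | zero => simpa using hj
    | succ m ih =>
      have h1 := h _ ih
      have h2 : (Fin.ofNat n m) + 1 = Fin.ofNat n (m + 1) := by
        ext; simp [Fin.val_add]
      rwa [add_assoc, h2] at h1
  have h := key (i - j).val
  have h3 : Fin.ofNat n (i - j).val = i - j := by ext; simp
  rwa [h3, add_sub_cancel] at h

/-- A family of zeros of `A` indexed by `Fin n`, the `k`-th of which is positive exactly off the
cyclic pair `{k, k + 1}`. -/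
def CyclicZeros (A : Matrix (Fin n) (Fin n) ℝ) (w : Fin n → Fin n → ℝ) : Prop :=
  ∀ k, IsZeroOf A (w k) ∧ ∀ i, 0 < w k i ↔ i ≠ k ∧ i ≠ k + 1

namespace CyclicZeros

lemma pos (hw : CyclicZeros A w) {k i : Fin n} (h : i ≠ k) (h' : i ≠ k + 1) : 0 < w k i :=
  ((hw k).2 i).2 ⟨h, h'⟩

lemma apply_self (hw : CyclicZeros A w) (k : Fin n) : w k k = 0 :=
  ((hw k).1.2.1 k).antisymm' (not_lt.1 fun h => (((hw k).2 k).1 h).1 rfl)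

lemma apply_succ (hw : CyclicZeros A w) (k : Fin n) : w k (k + 1) = 0 :=
  ((hw k).1.2.1 _).antisymm' (not_lt.1 fun h => (((hw k).2 _).1 h).2 rfl)

lemma mulVec_eq_zero (hA : A.IsSymm) (hcop : Copositive A) (hw : CyclicZeros A w) {k i : Fin n}
    (h : i ≠ k) (h' : i ≠ k + 1) : A.mulVec (w k) i = 0 :=
  (hw k).1.mulVec_eq_zero hA hcop (hw.pos h h')

lemma quadForm_nonneg (hA : A.IsSymm) (hcop : Copositive A) (hw : CyclicZeros A w) {k : Fin n}
    {x : Fin n → ℝ} (h : x k = 0) (h' : x (k + 1) = 0) : 0 ≤ x ⬝ᵥ A.mulVec x := by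
  refine (hw k).1.quadForm_nonneg hA hcop fun i hi => ?_
  by_cases h1 : i = k
  · rwa [h1]
  by_cases h2 : i = k + 1
  · rwa [h2]
  exact absurd hi (hw.pos h1 h2).ne'

lemma le_quadForm (hn : 3 ≤ n) (hA : A.IsSymm) (hcop : Copositive A) (hw : CyclicZeros A w)
    {k : Fin n} {x : Fin n → ℝ} (hx : x (k + 1) = 0) :
    2 * (x (k + 1 + 1) / w k (k + 1 + 1)) * (x k * A.mulVec (w k) k) ≤ x ⬝ᵥ A.mulVec x := by
  have h1 := Fin.add_one_ne_self (by omega) k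
  have h2 := Fin.add_one_add_one_ne_self hn k
  have hpos : 0 < w k (k + 1 + 1) := hw.pos h2 (Fin.add_one_ne_self (by omega) _)
  set c := x (k + 1 + 1) / w k (k + 1 + 1) with hc
  set y := x - c • w k with hy
  have hx' : x = y + c • w k := by simp [hy]
  have hy0 : 0 ≤ y ⬝ᵥ A.mulVec y :=
    hw.quadForm_nonneg hA hcop (k := k + 1) (by simp [hy, hx, hw.apply_succ])
      (by simp [hy, hc, hpos.ne'])
  have hyw : w k ⬝ᵥ A.mulVec y = x k * A.mulVec (w k) k := by
    rw [hA.dotProduct_mulVec_comm, dotProduct, Finset.sum_eq_single k]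
    · simp [hy, hw.apply_self]
    · intro i _ hi
      by_cases hi' : i = k + 1
      · subst hi'; simp [hy, hx, hw.apply_succ]
      · rw [hw.mulVec_eq_zero hA hcop hi hi', mul_zero]
    · simp
  conv_rhs => rw [hx']
  rw [quadForm_add_smul hA, hyw, (hw k).1.2.2]
  linarith

lemma mulVec_pos (hn : 3 ≤ n) (hA : A.IsSymm) (hcop : Copositive A) (hexc : Exceptional A)
    (hw : CyclicZeros A w) (k : Fin n) : 0 < A.mulVec (w k) k := by
  refine ((hw k).1.mulVec_nonneg hA hcop k).lt_of_ne fun h => ?_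
  obtain ⟨x, hx, hneg⟩ := hexc.exists_quadForm_neg_of_coord_eq_zero hA hcop (k + 1)
  have := hw.le_quadForm hn hA hcop hx
  rw [← h, mul_zero, mul_zero] at this
  linarith

/-- Every zero vanishes at two cyclically adjacent positions. -/
lemma exists_eq_zero (hn : 3 ≤ n) (hA : A.IsSymm) (hcop : Copositive A) (hexc : Exceptional A)
    (hw : CyclicZeros A w) {v : Fin n → ℝ} (hv : IsZeroOf A v) :
    ∃ k, v k = 0 ∧ v (k + 1) = 0 := by
  by_cases hfull : ∀ i, v i ≠ 0
  · obtain ⟨x, hx⟩ := hexc.exists_quadForm_neg hA (N := 0) (by simp) (by simp)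
    have := hv.quadForm_nonneg hA hcop (x := x) fun i hi => absurd hi (hfull i)
    rw [sub_zero] at hx
    linarith
  push Not at hfull
  obtain ⟨i, hi⟩ := hfull
  obtain ⟨k, rfl⟩ : ∃ k, i = k + 1 := ⟨i - 1, by simp⟩
  by_contra! hne
  have hk : 0 < v k := (hv.2.1 k).lt_of_ne fun h => hne k h.symm hi
  have hk2 : 0 < v (k + 1 + 1) := (hv.2.1 _).lt_of_ne fun h => hne _ hi h.symm
  have h := hw.le_quadForm hn hA hcop hi
  have h1 := hw.mulVec_pos hn hA hcop hexc k
  have h2 : 0 < w k (k + 1 + 1) :=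
    hw.pos (Fin.add_one_add_one_ne_self hn k) (Fin.add_one_ne_self (by omega) _)
  rw [hv.2.2] at h
  have : 0 < 2 * (v (k + 1 + 1) / w k (k + 1 + 1)) * (v k * A.mulVec (w k) k) := by positivity
  linarith

end CyclicZeros

/-- The vectors supported off `{k, k + 1}` whose restriction is in the kernel of the corresponding
principal submatrix of `A`. -/
def pairKer (A : Matrix (Fin n) (Fin n) ℝ) (k : Fin n) : Submodule ℝ (Fin n → ℝ) where
  carrier := {v | v k = 0 ∧ v (k + 1) = 0 ∧ ∀ i, i ≠ k → i ≠ k + 1 → A.mulVec v i = 0}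
  add_mem' {v v'} h h' := ⟨by simp [h.1, h'.1], by simp [h.2.1, h'.2.1], fun i hi hi' => by
    rw [mulVec_add, Pi.add_apply, h.2.2 i hi hi', h'.2.2 i hi hi', add_zero]⟩
  zero_mem' := by simp
  smul_mem' c v h := ⟨by simp [h.1], by simp [h.2.1], fun i hi hi' => by
    rw [mulVec_smul, Pi.smul_apply, h.2.2 i hi hi', smul_zero]⟩

namespace CyclicZeros

lemma mem_pairKer (hA : A.IsSymm) (hcop : Copositive A) (hw : CyclicZeros A w) (k : Fin n) :
    w k ∈ pairKer A k :=
  ⟨hw.apply_self k, hw.apply_succ k, fun _ => hw.mulVec_eq_zero hA hcop⟩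

lemma dotProduct_mulVec_eq_zero (hA : A.IsSymm) (hcop : Copositive A) (hw : CyclicZeros A w)
    {k : Fin n} {v : Fin n → ℝ} (h : v k = 0) (h' : v (k + 1) = 0) : w k ⬝ᵥ A.mulVec v = 0 := by
  rw [hA.dotProduct_mulVec_comm]
  refine Finset.sum_eq_zero fun i _ => ?_
  by_cases h1 : i = k
  · rw [h1, h, zero_mul]
  by_cases h2 : i = k + 1
  · rw [h2, h', zero_mul]
  rw [hw.mulVec_eq_zero hA hcop h1 h2, mul_zero]

lemma mulVec_apply_self_eq_zero (hn : 3 ≤ n) (hA : A.IsSymm) (hcop : Copositive A)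
    (hw : CyclicZeros A w) {k : Fin n} {v : Fin n → ℝ} (hv : v ∈ pairKer A k)
    (h : v (k + 1 + 1) = 0) : A.mulVec v k = 0 := by
  have h0 := hw.dotProduct_mulVec_eq_zero hA hcop hv.2.1 h
  rw [dotProduct, Finset.sum_eq_single k] at h0
  · exact (mul_eq_zero.1 h0).resolve_left (hw.pos (Fin.add_one_ne_self (by omega) k).symm
      (Fin.add_one_add_one_ne_self hn k).symm).ne'
  · intro i _ hi
    by_cases hi' : i = k + 1
    · rw [hi', hw.apply_self, zero_mul]
    · rw [hv.2.2 i hi hi', mul_zero]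
  · simp

lemma mulVec_apply_succ_eq_zero (hn : 3 ≤ n) (hA : A.IsSymm) (hcop : Copositive A)
    (hw : CyclicZeros A w) {k : Fin n} {v : Fin n → ℝ} (hv : v ∈ pairKer A (k + 1))
    (h : v k = 0) : A.mulVec v (k + 1 + 1) = 0 := by
  have h0 := hw.dotProduct_mulVec_eq_zero hA hcop h hv.1
  rw [dotProduct, Finset.sum_eq_single (k + 1 + 1)] at h0
  · exact (mul_eq_zero.1 h0).resolve_left (hw.pos (Fin.add_one_add_one_ne_self hn k)
      (Fin.add_one_ne_self (by omega) _)).ne'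
  · intro i _ hi
    by_cases hi' : i = k + 1
    · rw [hi', hw.apply_succ, zero_mul]
    · rw [hv.2.2 i hi' hi, mul_zero]
  · simp

lemma mem_pairKer_succ (hn : 3 ≤ n) (hA : A.IsSymm) (hcop : Copositive A)
    (hw : CyclicZeros A w) {k : Fin n} {v : Fin n → ℝ} (hv : v ∈ pairKer A k)
    (h : v (k + 1 + 1) = 0) : v ∈ pairKer A (k + 1) := by
  refine ⟨hv.2.1, h, fun i hi _ => ?_⟩
  by_cases hik : i = k
  · rw [hik, hw.mulVec_apply_self_eq_zero hn hA hcop hv h]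
  · exact hv.2.2 i hik hi

lemma finrank_pairKer_le_succ (hn : 3 ≤ n) (hA : A.IsSymm) (hcop : Copositive A)
    (hw : CyclicZeros A w) (k : Fin n) :
    Module.finrank ℝ (pairKer A k) ≤ Module.finrank ℝ (pairKer A (k + 1)) := by
  have hpos : 0 < w k (k + 1 + 1) :=
    hw.pos (Fin.add_one_add_one_ne_self hn k) (Fin.add_one_ne_self (by omega) _)
  let c : (Fin n → ℝ) →ₗ[ℝ] ℝ := (w k (k + 1 + 1))⁻¹ • LinearMap.proj (k + 1 + 1)
  have hc : ∀ v, c v = (w k (k + 1 + 1))⁻¹ * v (k + 1 + 1) := fun v => rfl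
  let T : (Fin n → ℝ) →ₗ[ℝ] (Fin n → ℝ) := LinearMap.id + c.smulRight (w (k + 1) - w k)
  have hT : ∀ v, T v = (v - c v • w k) + c v • w (k + 1) := fun v => by
    simp only [T, LinearMap.add_apply, LinearMap.id_apply, LinearMap.smulRight_apply, smul_sub]
    abel
  have hmem : ∀ v ∈ pairKer A k, T v ∈ pairKer A (k + 1) := fun v hv => by
    rw [hT]
    refine add_mem (hw.mem_pairKer_succ hn hA hcop
      (sub_mem hv (Submodule.smul_mem _ _ (hw.mem_pairKer hA hcop k))) ?_)
      (Submodule.smul_mem _ _ (hw.mem_pairKer hA hcop _))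
    rw [Pi.sub_apply, Pi.smul_apply, hc, smul_eq_mul]
    field_simp
    ring
  refine LinearMap.finrank_le_finrank_of_injective (f := T.restrict hmem) ?_
  rw [← LinearMap.ker_eq_bot, LinearMap.ker_eq_bot']
  rintro ⟨v, hv⟩ h
  have hTv : T v = 0 := congrArg Subtype.val h
  rw [hT] at hTv
  have hcv : c v = 0 := by
    have h1 := congrFun hTv k
    simp only [Pi.add_apply, Pi.sub_apply, Pi.smul_apply, smul_eq_mul, hv.1, hw.apply_self,
      Pi.zero_apply] at h1
    have h2 : 0 < w (k + 1) k := hw.pos (Fin.add_one_ne_self (by omega) k).symm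
      (Fin.add_one_add_one_ne_self hn k).symm
    have h3 : c v * w (k + 1) k = 0 := by linarith
    exact (mul_eq_zero.1 h3).resolve_right h2.ne'
  rw [hcv] at hTv
  simpa using hTv

lemma finrank_pairKer_eq (hn : 3 ≤ n) (hA : A.IsSymm) (hcop : Copositive A)
    (hw : CyclicZeros A w) (j k : Fin n) :
    Module.finrank ℝ (pairKer A j) = Module.finrank ℝ (pairKer A k) := by
  have key : ∀ j k : Fin n,
      Module.finrank ℝ (pairKer A j) ≤ Module.finrank ℝ (pairKer A k) := fun j =>
    Fin.forall_of_cyclic_succ (fun i hi => hi.trans (hw.finrank_pairKer_le_succ hn hA hcop i))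
      le_rfl
  exact (key j k).antisymm (key k j)

lemma eq_zero_of_mulVec_eq_zero (hn : 3 ≤ n) (hA : A.IsSymm) (hcop : Copositive A)
    (hexc : Exceptional A) (hw : CyclicZeros A w) {v : Fin n → ℝ} (hv : A.mulVec v = 0)
    {j : Fin n} (hj : v j = 0) : v = 0 := by
  have hstep : ∀ v : Fin n → ℝ, A.mulVec v = 0 → ∀ i, v i = 0 → v (i + 1) ≤ 0 := by
    intro v hv i hi
    by_contra! hi1
    obtain ⟨t, ht, h⟩ := exists_pos_forall_add_smul_nonneg (x := v) (hw i).1.2.1 fun m hm => by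
      by_cases h1 : m = i
      · rw [h1, hi]
      by_cases h2 : m = i + 1
      · rw [h2]; exact hi1.le
      · exact absurd hm (hw.pos h1 h2).ne'
    set z := w i + (t / 2) • v with hz
    have hzm : ∀ m, z m = w i m / 2 + (w i m + t * v m) / 2 := fun m => by
      simp only [hz, Pi.add_apply, Pi.smul_apply, smul_eq_mul]; ring
    have hzpos : ∀ m, m ≠ i → 0 < z m := fun m hm => by
      by_cases hm' : m = i + 1
      · rw [hzm, hm', hw.apply_succ]
        have := mul_pos ht hi1
        linarith
      · have := hw.pos hm hm'
        have := h m
        rw [hzm]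
        linarith
    have hi_ne := Fin.add_one_ne_self (by omega) i
    have hzero : IsZeroOf A z := by
      refine ⟨fun h0 => (hzpos _ hi_ne).ne' (congrFun h0 _), fun m => ?_, ?_⟩
      · rw [hzm]
        linarith [h m, (hw i).1.2.1 m]
      · rw [hz, quadForm_add_smul hA, (hw i).1.2.2, hA.dotProduct_mulVec_comm v, hv]
        simp
    obtain ⟨k, hk, hk'⟩ := hw.exists_eq_zero hn hA hcop hexc hzero
    have h1 : k = i := by_contra fun hne => (hzpos k hne).ne' hk
    have h2 : k + 1 = i := by_contra fun hne => (hzpos _ hne).ne' hk'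
    exact Fin.add_one_ne_self (by omega) k (h2.trans h1.symm)
  funext i
  refine Fin.forall_of_cyclic_succ (p := fun i => v i = 0) (fun i hi => ?_) hj i
  refine (hstep v hv i hi).antisymm ?_
  have := hstep (-v) (by rw [mulVec_neg, hv, neg_zero]) i (by simpa using hi)
  simpa using this

lemma finrank_pairKer_le_two (hn : 4 ≤ n) (hA : A.IsSymm) (hcop : Copositive A)
    (hexc : Exceptional A) (hw : CyclicZeros A w) (k : Fin n) :
    Module.finrank ℝ (pairKer A k) ≤ 2 := by
  by_contra! hlt
  obtain ⟨k, rfl⟩ : ∃ j, k = j + 1 := ⟨k - 1, by simp⟩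
  let f : pairKer A (k + 1) →ₗ[ℝ] ℝ × ℝ :=
    (LinearMap.prod (LinearMap.proj k) (LinearMap.proj (k + 1 + 1 + 1))).comp
      (pairKer A (k + 1)).subtype
  have hker : LinearMap.ker f ≠ ⊥ := LinearMap.ker_ne_bot_of_finrank_lt (by simpa using hlt)
  obtain ⟨⟨v, hv⟩, hfv, hv0⟩ := (Submodule.ne_bot_iff _).1 hker
  have hvk : v k = 0 := congrArg Prod.fst hfv
  have hvk3 : v (k + 1 + 1 + 1) = 0 := congrArg Prod.snd hfv
  refine hv0 (Subtype.ext (hw.eq_zero_of_mulVec_eq_zero (by omega) hA hcop hexc ?_ hvk))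
  funext i
  by_cases h1 : i = k + 1
  · rw [h1]
    exact hw.mulVec_apply_self_eq_zero (by omega) hA hcop hv hvk3
  by_cases h2 : i = k + 1 + 1
  · rw [h2]
    exact hw.mulVec_apply_succ_eq_zero (by omega) hA hcop hv hvk
  exact hv.2.2 i h1 h2

lemma one_le_finrank_pairKer (hA : A.IsSymm) (hcop : Copositive A) (hw : CyclicZeros A w)
    (k : Fin n) : 1 ≤ Module.finrank ℝ (pairKer A k) :=
  Submodule.one_le_finrank_iff.2 fun h => (hw k).1.1 <| by
    have := hw.mem_pairKer hA hcop k
    rwa [h, Submodule.mem_bot] at this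

lemma _root_.IsZeroOf.mem_pairKer (hA : A.IsSymm) (hcop : Copositive A) (hw : CyclicZeros A w)
    {v : Fin n → ℝ} (hv : IsZeroOf A v) {k : Fin n} (hk : v k = 0) (hk' : v (k + 1) = 0) :
    v ∈ pairKer A k := by
  refine ⟨hk, hk', fun i hi hi' => ?_⟩
  refine mulVec_eq_zero_of_quadForm_eq_zero hA (S := {i | i ≠ k ∧ i ≠ k + 1})
    (fun x hx => hw.quadForm_nonneg hA hcop (k := k) (hx _ ?_) (hx _ ?_))
    (fun j hj => ?_) hv.2.2 ⟨hi, hi'⟩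
  · simp
  · simp
  · by_cases hjk : j = k
    · rwa [hjk]
    · have : j = k + 1 := by_contra fun h => hj ⟨hjk, h⟩
      rwa [this]

lemma exists_eq_smul (hn : 3 ≤ n) (hA : A.IsSymm) (hcop : Copositive A)
    (hexc : Exceptional A) (hw : CyclicZeros A w)
    (h1 : ∀ k, Module.finrank ℝ (pairKer A k) = 1) {v : Fin n → ℝ} (hv : IsZeroOf A v) :
    ∃ k, ∃ c : ℝ, v = c • w k := by
  obtain ⟨k, hk, hk'⟩ := hw.exists_eq_zero hn hA hcop hexc hv
  have hwk : (⟨w k, hw.mem_pairKer hA hcop k⟩ : pairKer A k) ≠ 0 := fun h =>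
    (hw k).1.1 (congrArg Subtype.val h)
  obtain ⟨c, hc⟩ := (finrank_eq_one_iff_of_nonzero' _ hwk).1 (h1 k)
    ⟨v, hv.mem_pairKer hA hcop hw hk hk'⟩
  exact ⟨k, c, (congrArg Subtype.val hc).symm⟩

lemma minimalZero (hA : A.IsSymm) (hcop : Copositive A) (hw : CyclicZeros A w)
    (h1 : ∀ k, Module.finrank ℝ (pairKer A k) = 1) (k : Fin n) : MinimalZero A (w k) := by
  refine ⟨(hw k).1, fun v hv hss => ?_⟩
  have hz : ∀ i, w k i = 0 → v i = 0 := fun i hi =>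
    (hv.2.1 i).antisymm' (not_lt.1 fun h => (hss.1 h : 0 < w k i).ne' hi)
  have hwk : (⟨w k, hw.mem_pairKer hA hcop k⟩ : pairKer A k) ≠ 0 := fun h =>
    (hw k).1.1 (congrArg Subtype.val h)
  obtain ⟨c, hc⟩ := (finrank_eq_one_iff_of_nonzero' _ hwk).1 (h1 k)
    ⟨v, hv.mem_pairKer hA hcop hw (hz _ (hw.apply_self k)) (hz _ (hw.apply_succ k))⟩
  have hvc : c • w k = v := congrArg Subtype.val hc
  refine hss.2 fun i hi => ?_
  refine (hv.2.1 i).lt_of_ne fun h0 => hv.1 ?_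
  have hc0 : c = 0 := by
    rw [← hvc] at h0
    exact (mul_eq_zero.1 h0.symm).resolve_right (hi : 0 < w k i).ne'
  rw [← hvc, hc0, zero_smul]

end CyclicZeros

lemma mem_circIdx_add_one_add_one (hn : 3 ≤ n) (k i : Fin n) :
    i ∈ circIdx n (k + 1 + 1) ↔ i ≠ k ∧ i ≠ k + 1 := by
  obtain ⟨d, rfl⟩ : ∃ d, i = k + 1 + 1 + d := ⟨i - (k + 1 + 1), by simp⟩
  have h1 : k + 1 + 1 + d = k ↔ d.val = n - 2 := by
    rw [add_assoc, add_assoc, add_eq_left, Fin.ext_iff, Fin.val_add, Fin.val_add, Fin.val_one',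
      Fin.val_zero, Nat.mod_eq_of_lt (by omega : 1 < n), Nat.add_mod_mod]
    rcases lt_or_ge (1 + (1 + d.val)) n with h | h
    · rw [Nat.mod_eq_of_lt h]
      omega
    · rw [Nat.mod_eq_sub_mod h, Nat.mod_eq_of_lt (by omega)]
      omega
  have h2 : k + 1 + 1 + d = k + 1 ↔ d.val = n - 1 := by
    rw [add_assoc, add_eq_left, Fin.ext_iff, Fin.val_add, Fin.val_one', Fin.val_zero,
      Nat.mod_eq_of_lt (by omega : 1 < n)]
    rcases lt_or_ge (1 + d.val) n with h | h
    · rw [Nat.mod_eq_of_lt h]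
      omega
    · rw [Nat.mod_eq_sub_mod h, Nat.mod_eq_of_lt (by omega)]
      omega
  have h3 : k + 1 + 1 + d ∈ circIdx n (k + 1 + 1) ↔ d.val < n - 2 := by
    refine ⟨?_, fun h => ⟨⟨d.val, h⟩, rfl⟩⟩
    rintro ⟨s, hs⟩
    rw [← add_left_cancel hs]
    exact s.isLt
  rw [h3, Ne, Ne, h1, h2]
  omega

lemma rank_circSub_add_finrank_pairKer (hn : 3 ≤ n) (A : Matrix (Fin n) (Fin n) ℝ) (k : Fin n) :
    (circSub A (k + 1 + 1)).rank + Module.finrank ℝ (pairKer A k) = n - 2 := by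
  set e := circEmb n (k + 1 + 1)
  have he : Function.Injective e := fun _ _ h =>
    Fin.castLE_injective _ (add_left_cancel h)
  have hrange : ∀ i, i ∈ Set.range e ↔ i ≠ k ∧ i ≠ k + 1 := mem_circIdx_add_one_add_one hn k
  set F := Function.ExtendByZero.linearMap ℝ e with hF
  have hFe : ∀ y s, F y (e s) = y s := fun y s => he.extend_apply _ _ _
  have hF0 : ∀ y i, i ∉ Set.range e → F y i = 0 := fun y i hi => Function.extend_apply' _ _ _ hi
  have hmul : ∀ y s, A.mulVec (F y) (e s) = (circSub A (k + 1 + 1)).mulVec y s := fun y s => by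
    refine (Fintype.sum_of_injective e he _ _ (fun i hi => ?_) fun t => ?_).symm
    · rw [hF0 y i hi, mul_zero]
    · rw [hFe]; rfl
  have hmap : (LinearMap.ker (circSub A (k + 1 + 1)).mulVecLin).map F = pairKer A k := by
    ext v
    constructor
    · rintro ⟨y, hy, rfl⟩
      refine ⟨hF0 _ _ fun h => ((hrange _).1 h).1 rfl, hF0 _ _ fun h => ((hrange _).1 h).2 rfl,
        fun i hi hi' => ?_⟩
      obtain ⟨s, rfl⟩ := (hrange i).2 ⟨hi, hi'⟩
      rw [hmul]
      exact congrFun (LinearMap.mem_ker.1 hy) s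
    · rintro ⟨h1, h2, h3⟩
      have hFv : F (v ∘ e) = v := by
        funext i
        by_cases hi : i ∈ Set.range e
        · obtain ⟨s, rfl⟩ := hi
          exact hFe _ s
        · rw [hF0 _ i hi]
          by_cases hik : i = k
          · rw [hik, h1]
          · have : i = k + 1 := by_contra fun h => hi ((hrange i).2 ⟨hik, h⟩)
            rw [this, h2]
      refine ⟨v ∘ e, LinearMap.mem_ker.2 (funext fun s => ?_), hFv⟩
      obtain ⟨h4, h5⟩ := (hrange (e s)).1 ⟨s, rfl⟩
      rw [mulVecLin_apply, ← hmul, hFv, h3 _ h4 h5, Pi.zero_apply]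
  have hFinj : Function.Injective F := fun y y' h => funext fun s => by
    rw [← hFe y s, h, hFe]
  rw [← hmap, ← (Submodule.equivMapOfInjective F hFinj _).finrank_eq, Matrix.rank,
    LinearMap.finrank_range_add_finrank_ker]
  simp

end CyclicZeros

theorem statement4 (n : ℕ) (hn : 5 ≤ n) (A : Matrix (Fin n) (Fin n) ℝ)
    (hA : A.IsSymm) (hcop : Copositive A) (hexc : Exceptional A)
    (u : Fin n → Fin n → ℝ)
    (hu : ∀ j, IsZeroOf A (u j) ∧ supp (u j) = circIdx n j) :
    Xor'
      ((∀ j : Fin n, (circSub A j).rank = n - 3) ∧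
        (∀ v, IsZeroOf A v → ∃ j : Fin n, ∃ c : ℝ, v = c • u j) ∧
        (∀ j : Fin n, MinimalZero A (u j)))
      (∀ j : Fin n, (circSub A j).rank = n - 4) := by
  have : NeZero n := ⟨by omega⟩
  have hw : CyclicZeros A fun k => u (k + 1 + 1) := fun k =>
    ⟨(hu _).1, fun i => by
      rw [← mem_circIdx_add_one_add_one (by omega), ← (hu _).2]
      rfl⟩
  have hsurj : ∀ j : Fin n, ∃ k, j = k + 1 + 1 := fun j => ⟨j - 1 - 1, by simp⟩
  have hrank := rank_circSub_add_finrank_pairKer (by omega) A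
  have hpos := hw.one_le_finrank_pairKer hA hcop
  have htwo := hw.finrank_pairKer_le_two (by omega) hA hcop hexc
  have heq := hw.finrank_pairKer_eq (by omega) hA hcop
  by_cases h : ∀ k, Module.finrank ℝ (pairKer A k) = 1
  · refine Or.inl ⟨⟨fun j => ?_, fun v hv => ?_, fun j => ?_⟩, fun hall => ?_⟩
    · obtain ⟨k, rfl⟩ := hsurj j
      have := hrank k
      have := h k
      omega
    · obtain ⟨k, c, hc⟩ := hw.exists_eq_smul (by omega) hA hcop hexc h hv
      exact ⟨_, c, hc⟩
    · obtain ⟨k, rfl⟩ := hsurj j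
      exact hw.minimalZero hA hcop h k
    · have := hall (0 + 1 + 1)
      have := hrank 0
      have := h 0
      omega
  · push Not at h
    obtain ⟨k₀, hk₀⟩ := h
    have hall : ∀ j : Fin n, (circSub A j).rank = n - 4 := fun j => by
      obtain ⟨k, rfl⟩ := hsurj j
      have := hrank k
      have := heq k k₀
      have := hpos k
      have := htwo k
      omega
    refine Or.inr ⟨hall, fun hone => ?_⟩
    have h1 := hall (0 + 1 + 1)
    have h2 := hone.1 (0 + 1 + 1)
    omega
end
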